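/- Suppose the LAN condition holds for a parameter set Θ ⊆ ℝ with 0 ∈ Θ whose closure has nonempty interior, and let S_n : Ω_n → ℝ be a Θ-regular sequence of estimators with limit Q. Then there exists a probability measure ν on ℝ such that Q ∗ ε_θ = ν ∗ N(θ, 1/σ²) for every θ ∈ Θ, where N(θ, 1/σ²) denotes the Gaussian measure on ℝ with mean θ and variance 1/σ². -/

import Mathlib

open MeasureTheory ProbabilityTheory Filter Topology

/-- Weak convergence of a sequence of measures: convergence of the integrals of all bounded
continuous functions. -/
def WeaklyTendsTo {α : Type*} [MeasurableSpace α] [TopologicalSpace α]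
    (μ : ℕ → Measure α) (ν : Measure α) : Prop :=
  ∀ g : BoundedContinuousFunction α ℝ,
    Tendsto (fun n => ∫ x, g x ∂(μ n)) atTop (𝓝 (∫ x, g x ∂ν))

/-- The central inequality behind Le Cam's third lemma: replacing the likelihood ratio by `exp Y`
costs at most the probability that its logarithm is not close to `Y`. -/
lemma exp_neg_mul_integral_mul_sub_le {Ω : Type*} [MeasurableSpace Ω] (μ ν : Measure Ω)
    [IsProbabilityMeasure μ] [IsProbabilityMeasure ν] {Y f g : Ω → ℝ} (hY : Measurable Y)
    (hf : Measurable f) (hg : Measurable g) {C M ε : ℝ} (hε : 0 ≤ ε)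
    (hf0 : ∀ ω, 0 ≤ f ω) (hfC : ∀ ω, f ω ≤ C) (hg0 : ∀ ω, 0 ≤ g ω) (hgM : ∀ ω, g ω ≤ M)
    (hgY : ∀ ω, g ω ≤ Real.exp (Y ω)) (hgε : ∀ ω, |Y ω| ≤ ε → g ω = 0) :
    Real.exp (-ε) * ∫ ω, f ω * g ω ∂μ
        - C * M * μ.real {ω | ε ≤ |Real.log (ν.rnDeriv μ ω).toReal - Y ω|}
      ≤ ∫ ω, f ω ∂ν := by
  set B : Set Ω := {ω | ε ≤ |Real.log (ν.rnDeriv μ ω).toReal - Y ω|} with hB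
  have hBm : MeasurableSet B := by
    have := Measure.measurable_rnDeriv ν μ
    exact measurableSet_le measurable_const (by fun_prop)
  have hC (ω) : 0 ≤ C := (hf0 ω).trans (hfC ω)
  have hM (ω) : 0 ≤ M := (hg0 ω).trans (hgM ω)
  have hfν : Integrable f ν := .of_bound hf.aestronglyMeasurable C
    (.of_forall fun ω ↦ by rw [Real.norm_eq_abs, abs_of_nonneg (hf0 ω)]; exact hfC ω)
  have hfg : Integrable (fun ω ↦ f ω * g ω) μ :=
    .of_bound (hf.mul hg).aestronglyMeasurable (C * M) (.of_forall fun ω ↦ by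
      rw [Real.norm_eq_abs, abs_of_nonneg (mul_nonneg (hf0 ω) (hg0 ω))]
      exact mul_le_mul (hfC ω) (hgM ω) (hg0 ω) (hC ω))
  have hfd : Integrable f (μ.withDensity (ν.rnDeriv μ)) :=
    hfν.mono_measure (Measure.withDensity_rnDeriv_le ν μ)
  have hLf : Integrable (fun ω ↦ (ν.rnDeriv μ ω).toReal * f ω) μ := by
    have := (integrable_withDensity_iff_integrable_smul' (Measure.measurable_rnDeriv ν μ)
      (Measure.rnDeriv_lt_top ν μ)).1 hfd
    simpa using this
  have hLν : ∫ ω, (ν.rnDeriv μ ω).toReal * f ω ∂μ ≤ ∫ ω, f ω ∂ν := by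
    have h := integral_withDensity_eq_integral_toReal_smul (Measure.measurable_rnDeriv ν μ)
      (Measure.rnDeriv_lt_top ν μ) f
    simp only [smul_eq_mul] at h
    rw [← h]
    exact integral_mono_measure (Measure.withDensity_rnDeriv_le ν μ) (.of_forall hf0) hfν
  have hpt (ω) : Real.exp (-ε) * (f ω * g ω)
      ≤ (ν.rnDeriv μ ω).toReal * f ω + B.indicator (fun _ ↦ C * M) ω := by
    have hL0 : 0 ≤ (ν.rnDeriv μ ω).toReal := ENNReal.toReal_nonneg
    by_cases hω : ω ∈ B
    · rw [Set.indicator_of_mem hω]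
      have h1 : f ω * g ω ≤ C * M := mul_le_mul (hfC ω) (hgM ω) (hg0 ω) (hC ω)
      have h2 : Real.exp (-ε) * (f ω * g ω) ≤ f ω * g ω :=
        mul_le_of_le_one_left (mul_nonneg (hf0 ω) (hg0 ω)) (Real.exp_le_one_iff.2 (by linarith))
      nlinarith [mul_nonneg hL0 (hf0 ω)]
    · rw [Set.indicator_of_notMem hω, add_zero]
      have hlt : |Real.log (ν.rnDeriv μ ω).toReal - Y ω| < ε := not_le.1 hω
      have key : Real.exp (-ε) * g ω ≤ (ν.rnDeriv μ ω).toReal := by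
        rcases hL0.eq_or_lt with h0 | hpos
        · rw [← h0, Real.log_zero, zero_sub, abs_neg] at hlt
          rw [hgε ω hlt.le, mul_zero]
          exact hL0
        · calc Real.exp (-ε) * g ω ≤ Real.exp (-ε) * Real.exp (Y ω) := by gcongr; exact hgY ω
            _ = Real.exp (-ε + Y ω) := (Real.exp_add _ _).symm
            _ ≤ Real.exp (Real.log (ν.rnDeriv μ ω).toReal) := by
              gcongr
              linarith [(abs_lt.1 hlt).1]
            _ = _ := Real.exp_log hpos
      nlinarith [mul_le_mul_of_nonneg_right key (hf0 ω)]
  have hBi : Integrable (B.indicator fun _ ↦ C * M) μ := (integrable_const _).indicator hBm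
  have := integral_mono (hfg.const_mul (Real.exp (-ε))) (hLf.add hBi) hpt
  rw [integral_const_mul] at this
  simp only [Pi.add_apply] at this
  rw [integral_add hLf hBi, integral_indicator_const _ hBm, smul_eq_mul] at this
  linarith

/-- A continuous truncation of `exp`: bounded, below `exp y`, and vanishing for `|y| ≤ ε`. -/
noncomputable def truncatedExp (ε y : ℝ) : ℝ :=
  min (Real.exp y) (1 / ε) * min 1 (max 0 ((|y| - ε) / ε))

lemma continuous_truncatedExp (ε : ℝ) : Continuous (truncatedExp ε) := by
  unfold truncatedExp
  fun_prop

lemma truncatedExp_nonneg {ε : ℝ} (hε : 0 < ε) (y : ℝ) : 0 ≤ truncatedExp ε y := by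
  unfold truncatedExp
  positivity

lemma truncatedExp_le_min {ε : ℝ} (hε : 0 < ε) (y : ℝ) :
    truncatedExp ε y ≤ min (Real.exp y) (1 / ε) :=
  mul_le_of_le_one_right (by positivity) (min_le_left _ _)

lemma truncatedExp_eq_zero {ε y : ℝ} (hε : 0 < ε) (hy : |y| ≤ ε) : truncatedExp ε y = 0 := by
  have : (|y| - ε) / ε ≤ 0 := div_nonpos_of_nonpos_of_nonneg (by linarith) hε.le
  simp [truncatedExp, max_eq_left this]

lemma tendsto_truncatedExp {y : ℝ} (hy : y ≠ 0) :
    Tendsto (fun ε ↦ truncatedExp ε y) (𝓝[>] 0) (𝓝 (Real.exp y)) := by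
  refine tendsto_const_nhds.congr' ?_
  have h1 : Set.Ioo 0 (|y| / 2) ∈ 𝓝[>] (0 : ℝ) := Ioo_mem_nhdsGT (by positivity)
  have h2 : Set.Ioo 0 (1 / Real.exp y) ∈ 𝓝[>] (0 : ℝ) := Ioo_mem_nhdsGT (by positivity)
  filter_upwards [h1, h2] with ε he1 he2
  have h3 : 1 ≤ (|y| - ε) / ε := by
    rw [le_div_iff₀ he1.1]
    linarith [he1.2]
  have h4 : Real.exp y ≤ 1 / ε := by
    rw [le_div_iff₀ he1.1]
    have := (lt_div_iff₀ (Real.exp_pos y)).1 he2.2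
    linarith
  rw [truncatedExp, min_eq_left h4, max_eq_right (by linarith), min_eq_left h3, mul_one]

lemma integrable_exp_mul_of_map_eq_gaussian {Ω : Type*} [MeasurableSpace Ω] {ρ : Measure Ω}
    {X : Ω → ℝ} (hX : AEMeasurable X ρ) {m : ℝ} {v : NNReal} (hρ : ρ.map X = gaussianReal m v)
    (a : ℝ) : Integrable (fun ω ↦ Real.exp (a * X ω)) ρ := by
  have := integrable_exp_mul_gaussianReal (μ := m) (v := v) a
  rw [← hρ] at this
  exact this.comp_aemeasurable hX

lemma differentiable_integral_mul_cexp {Ω : Type*} [MeasurableSpace Ω] {ρ : Measure Ω}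
    {X : Ω → ℝ} {u : Ω → ℂ} (hX : AEMeasurable X ρ) (hu : AEStronglyMeasurable u ρ)
    (hu1 : ∀ ω, ‖u ω‖ ≤ 1) (hexp : ∀ a : ℝ, Integrable (fun ω ↦ Real.exp (a * X ω)) ρ) :
    Differentiable ℂ fun z : ℂ ↦ ∫ ω, u ω * Complex.exp (z * X ω) ∂ρ := by
  intro z₀
  have hXs : AEStronglyMeasurable (fun ω ↦ (X ω : ℂ)) ρ :=
    (Complex.measurable_ofReal.comp_aemeasurable hX).aestronglyMeasurable
  have hmeas (z : ℂ) : AEStronglyMeasurable (fun ω ↦ u ω * Complex.exp (z * X ω)) ρ :=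
    hu.mul (Complex.continuous_exp.comp_aestronglyMeasurable (hXs.const_mul z))
  have hnorm (z : ℂ) (ω) : ‖u ω * Complex.exp (z * X ω)‖ ≤ Real.exp (z.re * X ω) := by
    rw [norm_mul, Complex.norm_exp]
    simpa using mul_le_mul_of_nonneg_right (hu1 ω) (Real.exp_pos (z.re * X ω)).le
  set a := |z₀.re| + 2
  have hderiv := hasDerivAt_integral_of_dominated_loc_of_deriv_le (μ := ρ)
    (F := fun (z : ℂ) ω ↦ u ω * Complex.exp (z * X ω))
    (F' := fun (z : ℂ) ω ↦ u ω * Complex.exp (z * X ω) * X ω)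
    (bound := fun ω ↦ Real.exp (a * X ω) + Real.exp (-a * X ω))
    (Metric.ball_mem_nhds z₀ one_pos) (.of_forall hmeas)
    ((hexp z₀.re).mono' (hmeas z₀) (.of_forall (hnorm z₀)))
    ((hmeas z₀).mul hXs)
    (.of_forall fun ω z hz ↦ ?_) ((hexp a).add (hexp (-a))) (.of_forall fun ω z _ ↦ ?_)
  · exact hderiv.2.differentiableAt
  · have hre : |z.re| ≤ |z₀.re| + 1 := by
      have h1 : |(z - z₀).re| ≤ ‖z - z₀‖ := Complex.abs_re_le_norm _
      have h2 : ‖z - z₀‖ < 1 := by simpa [dist_eq_norm] using hz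
      have h3 : |z.re| ≤ |(z - z₀).re| + |z₀.re| := by
        simpa using abs_add_le (z - z₀).re z₀.re
      linarith
    have hx : |X ω| ≤ Real.exp |X ω| := by linarith [Real.add_one_le_exp |X ω|]
    calc ‖u ω * Complex.exp (z * X ω) * X ω‖
        ≤ Real.exp (z.re * X ω) * |X ω| := by
          rw [norm_mul, Complex.norm_real, Real.norm_eq_abs]
          gcongr
          exact hnorm z ω
      _ ≤ Real.exp (|z.re| * |X ω|) * Real.exp |X ω| := by
          gcongr ?_ * ?_
          rw [Real.exp_le_exp, ← abs_mul]
          exact le_abs_self _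
      _ = Real.exp ((|z.re| + 1) * |X ω|) := by rw [← Real.exp_add]; ring_nf
      _ ≤ Real.exp (a * |X ω|) := by
          gcongr
          simp only [a]
          linarith
      _ ≤ Real.exp (a * X ω) + Real.exp (-a * X ω) := by
          rcases abs_choice (X ω) with h | h <;> rw [h]
          · linarith [Real.exp_pos (-a * X ω)]
          · rw [mul_neg, ← neg_mul]
            linarith [Real.exp_pos (a * X ω)]
  · have h : HasDerivAt (fun z : ℂ ↦ z * (X ω : ℂ)) (X ω : ℂ) z := by
      simpa using (hasDerivAt_id z).mul_const (X ω : ℂ)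
    simpa [mul_assoc] using h.cexp.const_mul (u ω)

lemma frequently_nhdsNE_ofReal_mem {Θ : Set ℝ} (hΘ : (interior (closure Θ)).Nonempty) :
    ∃ z : ℝ, ∃ᶠ w : ℂ in 𝓝[≠] (z : ℂ), ∃ θ ∈ Θ, θ ≠ 0 ∧ w = θ := by
  obtain ⟨z, hz⟩ := hΘ
  refine ⟨z, ?_⟩
  have hreal : ∃ᶠ θ in 𝓝[≠] z, θ ∈ Θ ∧ θ ≠ 0 := by
    rw [frequently_nhdsWithin_iff, frequently_nhds_iff]
    intro U hzU hU
    have hne : ((U ∩ interior (closure Θ)) ∩ {z, 0}ᶜ).Nonempty := by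
      have hd : Dense ({z, 0}ᶜ : Set ℝ) := Set.Countable.dense_compl ℝ (Set.toFinite {z, 0}).countable
      exact hd.inter_open_nonempty _ (hU.inter isOpen_interior) ⟨z, hzU, hz⟩
    obtain ⟨y, ⟨hyU, hyi⟩, hyz⟩ := hne
    have hyc : y ∈ closure Θ := interior_subset hyi
    obtain ⟨θ, ⟨hθU, hθz⟩, hθ⟩ := mem_closure_iff.1 hyc (U ∩ {z, 0}ᶜ)
      (hU.inter (Set.toFinite {z, 0}).isClosed.isOpen_compl) ⟨hyU, hyz⟩
    simp only [Set.mem_compl_iff, Set.mem_insert_iff, Set.mem_singleton_iff, not_or] at hθz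
    exact ⟨θ, hθU, ⟨hθ, hθz.2⟩, hθz.1⟩
  have ht : Tendsto (fun x : ℝ ↦ (x : ℂ)) (𝓝[≠] z) (𝓝[≠] (z : ℂ)) :=
    Complex.continuous_ofReal.continuousAt.continuousWithinAt.tendsto_nhdsWithin
      fun x hx ↦ by simpa using hx
  exact ht.frequently (hreal.mono fun θ h ↦ ⟨θ, h.1, h.2, rfl⟩)

/-- Hájek's convolution theorem for a limiting Gaussian shift experiment. -/
lemma exists_eq_conv_gaussianReal {Θ : Set ℝ} (hΘ : (interior (closure Θ)).Nonempty)
    {σ : ℝ} (hσ : 0 < σ) {v w : NNReal} (hw : (w : ℝ) = 1 / σ ^ 2)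
    (ρ : Measure (ℝ × ℝ)) [IsProbabilityMeasure ρ] (hρ : ρ.map Prod.fst = gaussianReal 0 v)
    (Q : Measure ℝ) [IsProbabilityMeasure Q]
    (hshift : ∀ θ ∈ Θ, θ ≠ 0 → ∀ f : BoundedContinuousFunction ℝ ℝ,
      ∫ p, f p.2 * Real.exp (θ * p.1 - θ ^ 2 * σ ^ 2 / 2) ∂ρ = ∫ s, f (s + θ) ∂Q) :
    ∃ ν : Measure ℝ, IsProbabilityMeasure ν ∧
      ∀ θ : ℝ, Q.map (· + θ) = Measure.conv ν (gaussianReal θ w) := by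
  have hexp := integrable_exp_mul_of_map_eq_gaussian measurable_fst.aemeasurable hρ
  have hmeas : Measurable fun p : ℝ × ℝ ↦ p.2 - p.1 / σ ^ 2 := by fun_prop
  have hprob : IsProbabilityMeasure (ρ.map fun p : ℝ × ℝ ↦ p.2 - p.1 / σ ^ 2) :=
    Measure.isProbabilityMeasure_map hmeas.aemeasurable
  refine ⟨ρ.map fun p ↦ p.2 - p.1 / σ ^ 2, hprob, fun θ ↦ ?_⟩
  have : IsProbabilityMeasure (Q.map (· + θ)) :=
    Measure.isProbabilityMeasure_map (by fun_prop)
  refine Measure.ext_of_charFun (funext fun t ↦ ?_)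
  have hreal (η : ℝ) (hη : η ∈ Θ) (hη0 : η ≠ 0) :
      ∫ p, Complex.exp (t * p.2 * Complex.I) * Complex.exp (η * p.1) ∂ρ
        = Complex.exp (η ^ 2 * σ ^ 2 / 2) * (Complex.exp (t * η * Complex.I) * charFun Q t) := by
    let c : BoundedContinuousFunction ℝ ℝ := .ofNormedAddCommGroup (fun s ↦ Real.cos (t * s))
      (by fun_prop) 1 fun s ↦ Real.abs_cos_le_one _
    let d : BoundedContinuousFunction ℝ ℝ := .ofNormedAddCommGroup (fun s ↦ Real.sin (t * s))
      (by fun_prop) 1 fun s ↦ Real.abs_sin_le_one _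
    have hZ : Integrable (fun p : ℝ × ℝ ↦ Real.exp (η * p.1 - η ^ 2 * σ ^ 2 / 2)) ρ := by
      simp_rw [Real.exp_sub]
      exact (hexp η).div_const _
    have hi (f : BoundedContinuousFunction ℝ ℝ) :
        Integrable (fun p : ℝ × ℝ ↦ f p.2 * Real.exp (η * p.1 - η ^ 2 * σ ^ 2 / 2)) ρ :=
      hZ.bdd_mul (c := ‖f‖) (by fun_prop) (.of_forall fun p ↦ f.norm_coe_le_norm _)
    have hq (f : BoundedContinuousFunction ℝ ℝ) : Integrable (fun s ↦ f (s + η)) Q :=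
      .of_bound (by fun_prop) ‖f‖ (.of_forall fun p ↦ f.norm_coe_le_norm _)
    have hcd (s : ℝ) : Complex.exp (t * s * Complex.I) = (c s : ℂ) + (d s : ℂ) * Complex.I := by
      rw [Complex.exp_mul_I]
      simp [c, d]
    have hleft : ∫ p, Complex.exp (t * p.2 * Complex.I)
          * (Real.exp (η * p.1 - η ^ 2 * σ ^ 2 / 2) : ℝ) ∂ρ
        = ((∫ p, c p.2 * Real.exp (η * p.1 - η ^ 2 * σ ^ 2 / 2) ∂ρ : ℝ) : ℂ)
          + ((∫ p, d p.2 * Real.exp (η * p.1 - η ^ 2 * σ ^ 2 / 2) ∂ρ : ℝ) : ℂ) * Complex.I := by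
      rw [← integral_complex_ofReal, ← integral_complex_ofReal, ← integral_mul_const,
        ← integral_add (hi c).ofReal ((hi d).ofReal.mul_const _)]
      congr with p
      rw [hcd]
      push_cast
      ring
    have hright : Complex.exp (t * η * Complex.I) * charFun Q t
        = ((∫ s, c (s + η) ∂Q : ℝ) : ℂ) + ((∫ s, d (s + η) ∂Q : ℝ) : ℂ) * Complex.I := by
      rw [← integral_complex_ofReal, ← integral_complex_ofReal, ← integral_mul_const,
        ← integral_add (hq c).ofReal ((hq d).ofReal.mul_const _), charFun_apply_real,
        ← integral_const_mul]
      congr with s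
      rw [← hcd, ← Complex.exp_add]
      push_cast
      ring_nf
    rw [hright, ← hshift η hη hη0 c, ← hshift η hη hη0 d, ← hleft, ← integral_const_mul]
    congr with p
    push_cast
    simp only [← Complex.exp_add]
    ring_nf
  have hanal : (fun z : ℂ ↦ ∫ p, Complex.exp (t * p.2 * Complex.I) * Complex.exp (z * p.1) ∂ρ)
      = fun z ↦ Complex.exp (z ^ 2 * σ ^ 2 / 2)
          * (Complex.exp (t * z * Complex.I) * charFun Q t) := by
    obtain ⟨z₀, hz₀⟩ := frequently_nhdsNE_ofReal_mem hΘ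
    refine AnalyticOnNhd.eq_of_frequently_eq (z₀ := (z₀ : ℂ)) (𝕜 := ℂ)
      (fun z _ ↦ Differentiable.analyticAt ?_ z) (fun z _ ↦ Differentiable.analyticAt ?_ z)
      (hz₀.mono ?_)
    · refine differentiable_integral_mul_cexp measurable_fst.aemeasurable (by fun_prop)
        (fun p ↦ ?_) hexp
      rw [← Complex.ofReal_mul, Complex.norm_exp_ofReal_mul_I]
    · fun_prop
    · rintro _ ⟨η, hη, hη0, rfl⟩
      exact hreal η hη hη0
  have hσ' : (σ : ℂ) ≠ 0 := by exact_mod_cast hσ.ne'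
  have hν : charFun (ρ.map fun p : ℝ × ℝ ↦ p.2 - p.1 / σ ^ 2) t
      = Complex.exp (t ^ 2 / (2 * σ ^ 2)) * charFun Q t := by
    have h := congrFun hanal (-(t / σ ^ 2) * Complex.I)
    rw [charFun_apply_real, integral_map hmeas.aemeasurable (by fun_prop)]
    convert h using 1
    · congr with p
      rw [← Complex.exp_add]
      push_cast
      ring_nf
    · rw [← mul_assoc, ← Complex.exp_add]
      congr 2
      have hI := Complex.I_sq
      field_simp
      rw [show (Complex.I : ℂ) ^ 2 = -1 from hI]
      ring
  rw [charFun_conv, charFun_map_add_const, hν, charFun_gaussianReal, mul_comm, mul_right_comm,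
    ← Complex.exp_add]
  congr 2
  have hw' : (w : ℂ) = 1 / (σ : ℂ) ^ 2 := by exact_mod_cast congrArg (fun r : ℝ ↦ (r : ℂ)) hw
  rw [hw']
  simp
  field_simp
  ring

/-- One half of Le Cam's third lemma, along an arbitrary filter `F`. -/
lemma integral_mul_exp_le_of_tendsto {Ω : ℕ → Type*} [∀ n, MeasurableSpace (Ω n)]
    (μ ν : (n : ℕ) → Measure (Ω n)) [∀ n, IsProbabilityMeasure (μ n)]
    [∀ n, IsProbabilityMeasure (ν n)] {X S : (n : ℕ) → Ω n → ℝ}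
    (hX : ∀ n, Measurable (X n)) (hS : ∀ n, Measurable (S n)) {F : Filter ℕ} [F.NeBot]
    {θ σ : ℝ} (hθ : θ ≠ 0)
    (hLAN : ∀ ε > 0, Tendsto (fun n ↦ μ n {ω | ε ≤ |Real.log ((ν n).rnDeriv (μ n) ω).toReal
      - (θ * X n ω - θ ^ 2 * σ ^ 2 / 2)|}) F (𝓝 0))
    {v : NNReal} (hv : v ≠ 0) {m : ℝ} (ρ : Measure (ℝ × ℝ)) [IsProbabilityMeasure ρ]
    (hρ : ρ.map Prod.fst = gaussianReal m v)
    (hjoint : ∀ h : BoundedContinuousFunction (ℝ × ℝ) ℝ,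
      Tendsto (fun n ↦ ∫ ω, h (X n ω, S n ω) ∂(μ n)) F (𝓝 (∫ p, h p ∂ρ)))
    (f : BoundedContinuousFunction ℝ ℝ) (hf : ∀ s, 0 ≤ f s) {I : ℝ}
    (hI : Tendsto (fun n ↦ ∫ ω, f (S n ω) ∂(ν n)) F (𝓝 I)) :
    ∫ p, f p.2 * Real.exp (θ * p.1 - θ ^ 2 * σ ^ 2 / 2) ∂ρ ≤ I := by
  let Y : ℝ → ℝ := fun x ↦ θ * x - θ ^ 2 * σ ^ 2 / 2
  have hYc : Continuous Y := by fun_prop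
  have hfC (s : ℝ) : f s ≤ ‖f‖ := (le_abs_self _).trans (f.norm_coe_le_norm s)
  have hstep (ε : ℝ) (hε : 0 < ε) :
      Real.exp (-ε) * ∫ p, f p.2 * truncatedExp ε (Y p.1) ∂ρ ≤ I := by
    have hgM (y : ℝ) : truncatedExp ε y ≤ 1 / ε :=
      (truncatedExp_le_min hε y).trans (min_le_right _ _)
    have hc := continuous_truncatedExp ε
    let h : BoundedContinuousFunction (ℝ × ℝ) ℝ := .ofNormedAddCommGroup
      (fun p ↦ f p.2 * truncatedExp ε (Y p.1)) (by fun_prop) (‖f‖ * (1 / ε)) fun p ↦ by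
        rw [norm_mul, Real.norm_of_nonneg (truncatedExp_nonneg hε _)]
        exact mul_le_mul (f.norm_coe_le_norm _) (hgM _) (truncatedExp_nonneg hε _) (norm_nonneg f)
    have hbad := (ENNReal.tendsto_toReal ENNReal.zero_ne_top).comp (hLAN ε hε)
    have hlim := ((hjoint h).const_mul (Real.exp (-ε))).sub (hbad.const_mul (‖f‖ * (1 / ε)))
    rw [ENNReal.toReal_zero, mul_zero, sub_zero] at hlim
    refine le_of_tendsto_of_tendsto' hlim hI fun n ↦ ?_
    have hXn := hX n
    have hSn := hS n
    exact exp_neg_mul_integral_mul_sub_le (μ n) (ν n) (Y := fun ω ↦ Y (X n ω))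
      (f := fun ω ↦ f (S n ω)) (g := fun ω ↦ truncatedExp ε (Y (X n ω)))
      (hYc.measurable.comp hXn) (f.continuous.measurable.comp hSn)
      (hc.measurable.comp (hYc.measurable.comp hXn)) hε.le (fun _ ↦ hf _) (fun _ ↦ hfC _)
      (fun _ ↦ truncatedExp_nonneg hε _) (fun _ ↦ hgM _)
      (fun _ ↦ (truncatedExp_le_min hε _).trans (min_le_left _ _))
      (fun _ ↦ truncatedExp_eq_zero hε)
  have hint : Integrable (fun p : ℝ × ℝ ↦ ‖f‖ * Real.exp (Y p.1)) ρ := by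
    simp_rw [Y, Real.exp_sub]
    exact ((integrable_exp_mul_of_map_eq_gaussian measurable_fst.aemeasurable hρ θ).div_const
      _).const_mul _
  have hY0 : ∀ᵐ p ∂ρ, Y p.1 ≠ 0 := by
    have : NullSingletonClass (gaussianReal m v) := nullSingletonClass_gaussianReal hv
    have h1 : ∀ᵐ x ∂(ρ.map Prod.fst), x ≠ θ * σ ^ 2 / 2 := by
      rw [hρ, ae_iff]
      simp
    filter_upwards [ae_of_ae_map measurable_fst.aemeasurable h1] with p hp h0
    apply hp
    simp only [Y] at h0
    field_simp
    apply mul_left_cancel₀ hθ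
    linarith
  have hlim : Tendsto (fun ε ↦ ∫ p, f p.2 * truncatedExp ε (Y p.1) ∂ρ) (𝓝[>] 0)
      (𝓝 (∫ p, f p.2 * Real.exp (Y p.1) ∂ρ)) := by
    refine tendsto_integral_filter_of_dominated_convergence
      (fun p ↦ ‖f‖ * Real.exp (Y p.1)) (.of_forall fun ε ↦ ?_) ?_ hint ?_
    · have hc := continuous_truncatedExp ε
      exact Continuous.aestronglyMeasurable (by fun_prop)
    · filter_upwards [self_mem_nhdsWithin] with ε hε
      refine .of_forall fun p ↦ ?_
      rw [norm_mul, Real.norm_of_nonneg (truncatedExp_nonneg hε _)]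
      exact mul_le_mul (f.norm_coe_le_norm _) ((truncatedExp_le_min hε _).trans (min_le_left _ _))
        (truncatedExp_nonneg hε _) (norm_nonneg f)
    · filter_upwards [hY0] with p hp
      exact (tendsto_truncatedExp hp).const_mul _
  have hexp : Tendsto (fun ε : ℝ ↦ Real.exp (-ε)) (𝓝[>] 0) (𝓝 1) := by
    have : Continuous fun ε : ℝ ↦ Real.exp (-ε) := by fun_prop
    simpa using (this.tendsto 0).mono_left nhdsWithin_le_nhds
  have := hexp.mul hlim
  rw [one_mul] at this
  exact le_of_tendsto this (eventually_mem_nhdsWithin.mono hstep)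

/-- Le Cam's third lemma for a Gaussian shift limit, along an arbitrary filter `F`. -/
lemma integral_mul_exp_eq_of_tendsto {Ω : ℕ → Type*} [∀ n, MeasurableSpace (Ω n)]
    (μ ν : (n : ℕ) → Measure (Ω n)) [∀ n, IsProbabilityMeasure (μ n)]
    [∀ n, IsProbabilityMeasure (ν n)] {X S : (n : ℕ) → Ω n → ℝ}
    (hX : ∀ n, Measurable (X n)) (hS : ∀ n, Measurable (S n)) {F : Filter ℕ} [F.NeBot]
    {θ σ : ℝ} (hθ : θ ≠ 0) (hσ : σ ≠ 0)
    (hLAN : ∀ ε > 0, Tendsto (fun n ↦ μ n {ω | ε ≤ |Real.log ((ν n).rnDeriv (μ n) ω).toReal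
      - (θ * X n ω - θ ^ 2 * σ ^ 2 / 2)|}) F (𝓝 0))
    {v : NNReal} (hv : (v : ℝ) = σ ^ 2) (ρ : Measure (ℝ × ℝ)) [IsProbabilityMeasure ρ]
    (hρ : ρ.map Prod.fst = gaussianReal 0 v)
    (hjoint : ∀ h : BoundedContinuousFunction (ℝ × ℝ) ℝ,
      Tendsto (fun n ↦ ∫ ω, h (X n ω, S n ω) ∂(μ n)) F (𝓝 (∫ p, h p ∂ρ)))
    (f : BoundedContinuousFunction ℝ ℝ) {I : ℝ}
    (hI : Tendsto (fun n ↦ ∫ ω, f (S n ω) ∂(ν n)) F (𝓝 I)) :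
    ∫ p, f p.2 * Real.exp (θ * p.1 - θ ^ 2 * σ ^ 2 / 2) ∂ρ = I := by
  have hv0 : v ≠ 0 := by
    rintro rfl
    exact hσ (by simpa using hv.symm)
  have hZ : Integrable (fun p : ℝ × ℝ ↦ Real.exp (θ * p.1 - θ ^ 2 * σ ^ 2 / 2)) ρ := by
    simp_rw [Real.exp_sub]
    exact (integrable_exp_mul_of_map_eq_gaussian measurable_fst.aemeasurable hρ θ).div_const _
  have hZ1 : ∫ p, Real.exp (θ * p.1 - θ ^ 2 * σ ^ 2 / 2) ∂ρ = 1 := by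
    have h := mgf_gaussianReal hρ θ
    rw [mgf] at h
    simp_rw [Real.exp_sub]
    rw [integral_div, h, hv, div_eq_one_iff_eq (Real.exp_pos _).ne']
    ring_nf
  have hfZ : Integrable (fun p : ℝ × ℝ ↦ f p.2 * Real.exp (θ * p.1 - θ ^ 2 * σ ^ 2 / 2)) ρ :=
    hZ.bdd_mul (c := ‖f‖) (by fun_prop) (.of_forall fun p ↦ f.norm_coe_le_norm _)
  have hfS (n) : Integrable (fun ω ↦ f (S n ω)) (ν n) :=
    .of_bound (f.continuous.measurable.comp (hS n)).aestronglyMeasurable ‖f‖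
      (.of_forall fun _ ↦ f.norm_coe_le_norm _)
  have hle (s : ℝ) : |f s| ≤ ‖f‖ := f.norm_coe_le_norm s
  let a : BoundedContinuousFunction ℝ ℝ := .const ℝ ‖f‖
  have h1 := integral_mul_exp_le_of_tendsto μ ν hX hS hθ hLAN hv0 ρ hρ hjoint (a + f)
    (fun s ↦ by simpa [a] using by linarith [neg_abs_le (f s), hle s]) (I := ‖f‖ + I) (by
      have hsplit (n : ℕ) : ∫ ω, (a + f) (S n ω) ∂(ν n) = ‖f‖ + ∫ ω, f (S n ω) ∂(ν n) := by
        simp [a, integral_add (integrable_const _) (hfS n)]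
      simpa only [hsplit] using hI.const_add ‖f‖)
  have h2 := integral_mul_exp_le_of_tendsto μ ν hX hS hθ hLAN hv0 ρ hρ hjoint (a - f)
    (fun s ↦ by simpa [a] using by linarith [le_abs_self (f s), hle s]) (I := ‖f‖ - I) (by
      have hsplit (n : ℕ) : ∫ ω, (a - f) (S n ω) ∂(ν n) = ‖f‖ - ∫ ω, f (S n ω) ∂(ν n) := by
        simp [a, integral_sub (integrable_const _) (hfS n)]
      simpa only [hsplit] using hI.const_sub ‖f‖)
  simp only [BoundedContinuousFunction.coe_add, BoundedContinuousFunction.coe_sub, Pi.add_apply,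
    Pi.sub_apply, a, BoundedContinuousFunction.const_apply, add_mul, sub_mul] at h1 h2
  rw [integral_add (hZ.const_mul _) hfZ, integral_const_mul, hZ1, mul_one] at h1
  rw [integral_sub (hZ.const_mul _) hfZ, integral_const_mul, hZ1, mul_one] at h2
  linarith

lemma WeaklyTendsTo.isTightMeasureSet_range {μ : ℕ → Measure ℝ} {ν : Measure ℝ}
    [∀ n, IsProbabilityMeasure (μ n)] [IsProbabilityMeasure ν] (h : WeaklyTendsTo μ ν) :
    IsTightMeasureSet (Set.range μ) := by
  let μ' : ℕ → ProbabilityMeasure ℝ := fun n ↦ ⟨μ n, inferInstance⟩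
  have ht : Tendsto μ' atTop (𝓝 (⟨ν, inferInstance⟩ : ProbabilityMeasure ℝ)) :=
    ProbabilityMeasure.tendsto_iff_forall_integral_tendsto.2 h
  have hc : IsCompact (closure (Set.range μ')) :=
    ht.isCompact_insert_range.closure_of_subset (Set.subset_insert _ _)
  refine (isTightMeasureSet_of_isCompact_closure hc).subset ?_
  rintro _ ⟨n, rfl⟩
  exact ⟨μ' n, ⟨n, rfl⟩, rfl⟩

/-- Joint laws with weakly convergent marginals converge weakly along some finer filter. -/
lemma exists_weak_limit_prodMk {Ω : ℕ → Type*} [∀ n, MeasurableSpace (Ω n)]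
    (μ : (n : ℕ) → Measure (Ω n)) [∀ n, IsProbabilityMeasure (μ n)] {X S : (n : ℕ) → Ω n → ℝ}
    (hX : ∀ n, Measurable (X n)) (hS : ∀ n, Measurable (S n)) {α β : Measure ℝ}
    [IsProbabilityMeasure α] [IsProbabilityMeasure β]
    (hα : WeaklyTendsTo (fun n ↦ (μ n).map (X n)) α)
    (hβ : WeaklyTendsTo (fun n ↦ (μ n).map (S n)) β) :
    ∃ (F : Filter ℕ) (ρ : Measure (ℝ × ℝ)), F.NeBot ∧ F ≤ atTop ∧ IsProbabilityMeasure ρ ∧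
      ρ.map Prod.fst = α ∧ ∀ h : BoundedContinuousFunction (ℝ × ℝ) ℝ,
        Tendsto (fun n ↦ ∫ ω, h (X n ω, S n ω) ∂(μ n)) F (𝓝 (∫ p, h p ∂ρ)) := by
  have hm (n) : Measurable fun ω ↦ (X n ω, S n ω) := (hX n).prodMk (hS n)
  have hpX (n) : IsProbabilityMeasure ((μ n).map (X n)) :=
    Measure.isProbabilityMeasure_map (hX n).aemeasurable
  have hpS (n) : IsProbabilityMeasure ((μ n).map (S n)) :=
    Measure.isProbabilityMeasure_map (hS n).aemeasurable
  let κ : ℕ → ProbabilityMeasure (ℝ × ℝ) := fun n ↦ ⟨(μ n).map fun ω ↦ (X n ω, S n ω),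
    Measure.isProbabilityMeasure_map (hm n).aemeasurable⟩
  have hκ (h : BoundedContinuousFunction (ℝ × ℝ) ℝ) (n : ℕ) :
      ∫ p, h p ∂(κ n : Measure (ℝ × ℝ)) = ∫ ω, h (X n ω, S n ω) ∂(μ n) :=
    integral_map (hm n).aemeasurable (by fun_prop)
  have htight : IsTightMeasureSet {((κ' : ProbabilityMeasure (ℝ × ℝ)) : Measure (ℝ × ℝ)) |
      κ' ∈ Set.range κ} := by
    refine .prodMk (hα.isTightMeasureSet_range.subset ?_) (hβ.isTightMeasureSet_range.subset ?_)
    · rintro _ ⟨_, ⟨_, ⟨n, rfl⟩, rfl⟩, rfl⟩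
      exact ⟨n, (Measure.fst_map_prodMk (hS n)).symm⟩
    · rintro _ ⟨_, ⟨_, ⟨n, rfl⟩, rfl⟩, rfl⟩
      exact ⟨n, (Measure.snd_map_prodMk (hX n)).symm⟩
  obtain ⟨ρ, -, hρ⟩ := (isCompact_closure_of_isTightMeasureSet htight).ultrafilter_le_nhds
    ((hyperfilter ℕ).map κ)
    (le_principal_iff.2 (mem_map.2 (Eventually.of_forall fun n ↦ subset_closure ⟨n, rfl⟩)))
  have hle : (hyperfilter ℕ : Filter ℕ) ≤ atTop := Nat.hyperfilter_le_atTop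
  have hlim : ∀ h : BoundedContinuousFunction (ℝ × ℝ) ℝ, Tendsto
      (fun n ↦ ∫ ω, h (X n ω, S n ω) ∂(μ n)) (hyperfilter ℕ) (𝓝 (∫ p, h p ∂ρ)) := fun h ↦ by
    simpa only [hκ] using ProbabilityMeasure.tendsto_iff_forall_integral_tendsto.1
      (show Tendsto κ (hyperfilter ℕ) (𝓝 ρ) from hρ) h
  refine ⟨hyperfilter ℕ, ρ, inferInstance, hle, inferInstance, ?_, hlim⟩
  have : IsProbabilityMeasure ((ρ : Measure (ℝ × ℝ)).map Prod.fst) :=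
    Measure.isProbabilityMeasure_map measurable_fst.aemeasurable
  refine ext_of_forall_integral_eq_of_IsFiniteMeasure fun f ↦ ?_
  rw [integral_map measurable_fst.aemeasurable (by fun_prop)]
  refine tendsto_nhds_unique
    (hlim (f.compContinuous ⟨Prod.fst, continuous_fst⟩)) (((hα f).mono_left hle).congr fun n ↦ ?_)
  exact integral_map (hX n).aemeasurable (by fun_prop)

theorem stmt1
    (Θ : Set ℝ) (hΘ0 : (0 : ℝ) ∈ Θ) (hΘint : (interior (closure Θ)).Nonempty)
    (Ω : ℕ → Type*) [∀ n, MeasurableSpace (Ω n)]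
    (P : (n : ℕ) → ℝ → Measure (Ω n))
    (hP : ∀ n, ∀ θ ∈ Θ, IsProbabilityMeasure (P n θ))
    (σ : ℝ) (hσ : 0 < σ)
    (X : (n : ℕ) → Ω n → ℝ) (hX : ∀ n, Measurable (X n))
    -- LAN (i): the log-likelihood ratio expansion holds in `P n 0`-probability
    (hLAN : ∀ θ ∈ Θ, ∀ ε > 0,
      Tendsto (fun n => P n 0 {ω | ε ≤
          |Real.log ((P n θ).rnDeriv (P n 0) ω).toReal
            - (θ * X n ω - θ ^ 2 * σ ^ 2 / 2)|}) atTop (𝓝 0))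
    -- LAN (ii): the central sequence is asymptotically `N(0, σ²)` under `P n 0`
    (hCLT : WeaklyTendsTo (fun n => (P n 0).map (X n))
      (gaussianReal 0 ⟨σ ^ 2, sq_nonneg σ⟩))
    -- `S n` is a Θ-regular sequence of estimators with limit `Q`
    (S : (n : ℕ) → Ω n → ℝ) (hS : ∀ n, Measurable (S n))
    (Q : Measure ℝ) (hQ : IsProbabilityMeasure Q)
    (hreg : ∀ θ ∈ Θ, WeaklyTendsTo (fun n => (P n θ).map (S n)) (Q.map (· + θ))) :
    ∃ ν : Measure ℝ, IsProbabilityMeasure ν ∧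
      ∀ θ ∈ Θ, Q.map (· + θ)
        = Measure.conv ν (gaussianReal θ ⟨1 / σ ^ 2, by positivity⟩) := by
  have hP0 (n) : IsProbabilityMeasure (P n 0) := hP n 0 hΘ0
  have hQ0 : WeaklyTendsTo (fun n ↦ (P n 0).map (S n)) Q := by
    simpa using hreg 0 hΘ0
  obtain ⟨F, ρ, hF, hle, hρprob, hρ, hjoint⟩ :=
    exists_weak_limit_prodMk (α := gaussianReal 0 (.mk (σ ^ 2) (sq_nonneg σ)))
      (fun n ↦ P n 0) hX hS hCLT hQ0
  have hshift (θ : ℝ) (hθ : θ ∈ Θ) (hθ0 : θ ≠ 0) (f : BoundedContinuousFunction ℝ ℝ) :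
      ∫ p, f p.2 * Real.exp (θ * p.1 - θ ^ 2 * σ ^ 2 / 2) ∂ρ = ∫ s, f (s + θ) ∂Q := by
    have hPθ (n) : IsProbabilityMeasure (P n θ) := hP n θ hθ
    refine integral_mul_exp_eq_of_tendsto (fun n ↦ P n 0) (fun n ↦ P n θ) hX hS hθ0 hσ.ne'
      (fun ε hε ↦ (hLAN θ hθ ε hε).mono_left hle) rfl ρ hρ hjoint f ?_
    have h := (hreg θ hθ f).mono_left hle
    rw [integral_map (by fun_prop) (by fun_prop)] at h
    exact h.congr fun n ↦ integral_map (hS n).aemeasurable (by fun_prop)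
  obtain ⟨ν, hν, h⟩ := exists_eq_conv_gaussianReal hΘint hσ
    (w := .mk (1 / σ ^ 2) (by positivity)) rfl ρ hρ Q hshift
  exact ⟨ν, hν, fun θ _ ↦ h θ⟩
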